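/- For every ε with 0 < ε < 1 there exist unit vectors x_evt, x_evt_neg, x_img_pos, x_img_neg, x_txt in the Euclidean space ℝ³ such that the event embeddings are ε-close in cosine similarity to their paired image embeddings, i.e. ⟪x_evt, x_img_pos⟫ ≥ 1 − ε and ⟪x_evt_neg, x_img_neg⟫ ≥ 1 − ε, the image–text ordering holds, i.e. ⟪x_img_pos, x_txt⟫ > ⟪x_img_neg, x_txt⟫, and yet the event–text ordering is strictly reversed: ⟪x_evt, x_txt⟫ < ⟪x_evt_neg, x_txt⟫. -/

import Mathlib

open RealInnerProductSpace

/-- Quantitative Lemma 1 (paper): even when paired cosine similarities are at least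
`1 − ε`, the event–text ordering can be strictly reversed. -/
theorem forall_eps_exists_near_aligned_but_event_text_order_reversed :
    ∀ ε : ℝ, 0 < ε → ε < 1 →
      ∃ x_evt x_evt_neg x_img_pos x_img_neg x_txt : EuclideanSpace ℝ (Fin 3),
        ‖x_evt‖ = 1 ∧ ‖x_evt_neg‖ = 1 ∧ ‖x_img_pos‖ = 1 ∧ ‖x_img_neg‖ = 1 ∧ ‖x_txt‖ = 1 ∧
        ⟪x_evt, x_img_pos⟫ ≥ 1 - ε ∧
        ⟪x_evt_neg, x_img_neg⟫ ≥ 1 - ε ∧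
        ⟪x_img_pos, x_txt⟫ > ⟪x_img_neg, x_txt⟫ ∧
        ⟪x_evt, x_txt⟫ < ⟪x_evt_neg, x_txt⟫ := by
  intro ε hε0 hε1
  obtain ⟨c, s, hs, hcs, hε⟩ : ∃ c s : ℝ, 0 < s ∧ c ^ 2 + s ^ 2 = 1 ∧ 2 * s ^ 2 = ε := by
    refine ⟨√(1 - ε / 2), √(ε / 2), Real.sqrt_pos.2 (by linarith), ?_, ?_⟩
    · rw [Real.sq_sqrt (by linarith), Real.sq_sqrt (by linarith)]
      ring
    · rw [Real.sq_sqrt (by linarith)]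
      ring
  refine ⟨!₂[c, -s, 0], !₂[c, s, 0], !₂[c, s, 0], !₂[c, -s, 0], !₂[0, 1, 0],
    ?_, ?_, ?_, ?_, ?_, ?_, ?_, ?_, ?_⟩
  all_goals
    simp [EuclideanSpace.norm_eq, PiLp.inner_apply, Fin.sum_univ_three, hcs]
  all_goals nlinarith
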